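/- Fix constants C₂ ≥ 1 and 0 < s ≤ C₂, and fix y ∈ ℝ with |y| ≤ 1. Define F(α, m, σ) = α · φ_σ(y − m) on the domain D = [0,1] × [−C₂, C₂] × [s, C₂]. Then there exists a constant κ > 0, depending only on C₂ (not on s or y), such that for all (α, m, σ) in the interior of D: |∂F/∂α(α, m, σ)| ≤ κ/s, |∂F/∂m(α, m, σ)| ≤ κ/s², and |∂F/∂σ(α, m, σ)| ≤ κ/s³. -/

import Mathlib

open MeasureTheory

/-- The centered Gaussian density with standard deviation `σ`. -/
noncomputable def gaussPdf (σ z : ℝ) : ℝ :=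
  (Real.sqrt (2 * Real.pi * σ ^ 2))⁻¹ * Real.exp (-(z ^ 2) / (2 * σ ^ 2))

theorem gaussPdf_eq {σ : ℝ} (hσ : 0 < σ) (z : ℝ) :
    gaussPdf σ z =
      (Real.sqrt (2 * Real.pi))⁻¹ * (σ⁻¹ * Real.exp (-(z ^ 2) / (2 * σ ^ 2))) := by
  rw [gaussPdf, Real.sqrt_mul (by positivity), Real.sqrt_sq hσ.le, mul_inv, mul_assoc]

theorem gaussPdf_nonneg (σ z : ℝ) : 0 ≤ gaussPdf σ z := by
  unfold gaussPdf
  positivity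

/-- A Gaussian density decays at least like the inverse of a quadratic. -/
theorem gaussPdf_mul_one_add_le {σ : ℝ} (hσ : 0 < σ) (z : ℝ) :
    gaussPdf σ z * (1 + z ^ 2 / (2 * σ ^ 2)) ≤ 1 / σ := by
  have hsqrt : (Real.sqrt (2 * Real.pi))⁻¹ ≤ 1 :=
    inv_le_one_of_one_le₀ (Real.one_le_sqrt.mpr (by linarith [Real.two_le_pi]))
  have hexp : Real.exp (-(z ^ 2) / (2 * σ ^ 2)) * (1 + z ^ 2 / (2 * σ ^ 2)) ≤ 1 := by
    rw [neg_div, Real.exp_neg, inv_mul_le_one₀ (Real.exp_pos _), add_comm]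
    exact Real.add_one_le_exp _
  calc gaussPdf σ z * (1 + z ^ 2 / (2 * σ ^ 2))
      = (Real.sqrt (2 * Real.pi))⁻¹ *
          (σ⁻¹ * (Real.exp (-(z ^ 2) / (2 * σ ^ 2)) * (1 + z ^ 2 / (2 * σ ^ 2)))) := by
        rw [gaussPdf_eq hσ]; ring
    _ ≤ 1 * (σ⁻¹ * 1) := by gcongr
    _ = 1 / σ := by ring

theorem gaussPdf_le {σ : ℝ} (hσ : 0 < σ) (z : ℝ) : gaussPdf σ z ≤ 1 / σ :=
  (le_mul_of_one_le_right (gaussPdf_nonneg σ z)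
    (le_add_of_nonneg_right (by positivity))).trans (gaussPdf_mul_one_add_le hσ z)

theorem hasDerivAt_gaussPdf {σ : ℝ} (hσ : 0 < σ) (z : ℝ) :
    HasDerivAt (gaussPdf σ) (gaussPdf σ z * (-(z / σ ^ 2))) z := by
  have h := ((((hasDerivAt_id z).pow 2).neg.div_const (2 * σ ^ 2)).exp).const_mul
    (Real.sqrt (2 * Real.pi * σ ^ 2))⁻¹
  refine h.congr_deriv ?_
  simp only [gaussPdf, id, Pi.pow_apply, Pi.neg_apply]
  field_simp
  simp

theorem hasDerivAt_gaussPdf_std {σ : ℝ} (hσ : 0 < σ) (z : ℝ) :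
    HasDerivAt (fun σ' => gaussPdf σ' z) (gaussPdf σ z * (z ^ 2 / σ ^ 3 - 1 / σ)) σ := by
  have hden : HasDerivAt (fun σ' : ℝ => 2 * σ' ^ 2) (2 * (2 * σ)) σ := by
    simpa using (hasDerivAt_pow 2 σ).const_mul 2
  have hquot := (hasDerivAt_const σ (-(z ^ 2))).fun_div hden (by positivity)
  have h := ((hasDerivAt_inv hσ.ne').fun_mul hquot.exp).const_mul (Real.sqrt (2 * Real.pi))⁻¹
  have heq : (fun σ' => gaussPdf σ' z) =ᶠ[nhds σ] fun σ' =>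
      (Real.sqrt (2 * Real.pi))⁻¹ * (σ'⁻¹ * Real.exp (-(z ^ 2) / (2 * σ' ^ 2))) := by
    filter_upwards [lt_mem_nhds hσ] with σ' hσ' using gaussPdf_eq hσ' z
  refine (h.congr_of_eventuallyEq heq).congr_deriv ?_
  rw [gaussPdf_eq hσ]
  field_simp
  ring

theorem abs_gaussPdf_mul_deriv_factor_le {σ : ℝ} (hσ : 0 < σ) (z : ℝ) :
    |gaussPdf σ z * (-(z / σ ^ 2))| ≤ 1 / σ ^ 2 := by
  have hfactor : |z / σ ^ 2| ≤ (1 + z ^ 2 / (2 * σ ^ 2)) / σ := by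
    have h : |z / σ| ≤ 1 + (z / σ) ^ 2 / 2 := by
      rw [abs_le]
      constructor <;> nlinarith [sq_nonneg (z / σ - 1), sq_nonneg (z / σ + 1)]
    calc |z / σ ^ 2| = |z / σ| / σ := by
          rw [← abs_of_pos hσ, ← abs_div, abs_of_pos hσ, div_div, sq]
      _ ≤ (1 + (z / σ) ^ 2 / 2) / σ := by gcongr
      _ = (1 + z ^ 2 / (2 * σ ^ 2)) / σ := by field_simp
  rw [abs_mul, abs_neg, abs_of_nonneg (gaussPdf_nonneg σ z)]
  calc gaussPdf σ z * |z / σ ^ 2|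
      ≤ gaussPdf σ z * ((1 + z ^ 2 / (2 * σ ^ 2)) / σ) :=
        mul_le_mul_of_nonneg_left hfactor (gaussPdf_nonneg σ z)
    _ = gaussPdf σ z * (1 + z ^ 2 / (2 * σ ^ 2)) / σ := by ring
    _ ≤ 1 / σ / σ := by gcongr; exact gaussPdf_mul_one_add_le hσ z
    _ = 1 / σ ^ 2 := by rw [div_div, sq]

theorem abs_gaussPdf_mul_deriv_std_factor_le {σ : ℝ} (hσ : 0 < σ) (z : ℝ) :
    |gaussPdf σ z * (z ^ 2 / σ ^ 3 - 1 / σ)| ≤ 2 / σ ^ 2 := by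
  have hfactor : |z ^ 2 / σ ^ 3 - 1 / σ| ≤ 2 * (1 + z ^ 2 / (2 * σ ^ 2)) / σ := by
    have hsplit : 2 * (1 + z ^ 2 / (2 * σ ^ 2)) / σ = z ^ 2 / σ ^ 3 + 2 * (1 / σ) := by
      field_simp
      ring
    have h₁ : 0 ≤ z ^ 2 / σ ^ 3 := by positivity
    have h₂ : 0 < 1 / σ := by positivity
    rw [hsplit, abs_le]
    constructor <;> linarith
  rw [abs_mul, abs_of_nonneg (gaussPdf_nonneg σ z)]
  calc gaussPdf σ z * |z ^ 2 / σ ^ 3 - 1 / σ|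
      ≤ gaussPdf σ z * (2 * (1 + z ^ 2 / (2 * σ ^ 2)) / σ) :=
        mul_le_mul_of_nonneg_left hfactor (gaussPdf_nonneg σ z)
    _ = 2 * (gaussPdf σ z * (1 + z ^ 2 / (2 * σ ^ 2))) / σ := by ring
    _ ≤ 2 * (1 / σ) / σ := by gcongr; exact gaussPdf_mul_one_add_le hσ z
    _ = 2 / σ ^ 2 := by field_simp

/-- Lemma 5 derivative bounds: for `F(α, m, σ) = α φ_σ(y - m)` on
`D = [0,1] × [-C₂, C₂] × [s, C₂]`, there is a constant `κ` depending only on `C₂`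
(not on `s` or `y`) bounding the partial derivatives on the interior of `D` by
`κ/s`, `κ/s²` and `κ/s³` respectively. -/
theorem mixture_component_partial_deriv_bounds
    (C₂ : ℝ) (hC₂ : 1 ≤ C₂) :
    ∃ κ > (0 : ℝ), ∀ s : ℝ, 0 < s → s ≤ C₂ → ∀ y : ℝ, |y| ≤ 1 →
      ∀ α ∈ Set.Ioo (0 : ℝ) 1, ∀ m ∈ Set.Ioo (-C₂) C₂, ∀ σ ∈ Set.Ioo s C₂,
        |deriv (fun a : ℝ => a * gaussPdf σ (y - m)) α| ≤ κ / s ∧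
        |deriv (fun m' : ℝ => α * gaussPdf σ (y - m')) m| ≤ κ / s ^ 2 ∧
        |deriv (fun σ' : ℝ => α * gaussPdf σ' (y - m)) σ| ≤ κ / s ^ 3 := by
  refine ⟨2 * C₂, by linarith, fun s hs hsC y _ α hα m _ σ hσ => ?_⟩
  have hσpos : 0 < σ := hs.trans hσ.1
  have hsσ : s ≤ σ := hσ.1.le
  have hweight : ∀ x : ℝ, |α * x| ≤ |x| := fun x => by
    rw [abs_mul, abs_of_pos hα.1]
    exact mul_le_of_le_one_left (abs_nonneg x) hα.2.le
  refine ⟨?_, ?_, ?_⟩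
  · rw [((hasDerivAt_id' α).mul_const _).deriv, one_mul, abs_of_nonneg (gaussPdf_nonneg _ _)]
    calc gaussPdf σ (y - m) ≤ 1 / σ := gaussPdf_le hσpos _
      _ ≤ 2 * C₂ / s := by gcongr; linarith
  · have h := ((hasDerivAt_gaussPdf hσpos (y - m)).comp_const_sub y m).const_mul α
    rw [h.deriv]
    refine (hweight _).trans ?_
    rw [abs_neg]
    calc |gaussPdf σ (y - m) * (-((y - m) / σ ^ 2))| ≤ 1 / σ ^ 2 :=
          abs_gaussPdf_mul_deriv_factor_le hσpos _
      _ ≤ 2 * C₂ / s ^ 2 := by gcongr; linarith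
  · rw [((hasDerivAt_gaussPdf_std hσpos (y - m)).const_mul α).deriv]
    refine (hweight _).trans ?_
    calc |gaussPdf σ (y - m) * ((y - m) ^ 2 / σ ^ 3 - 1 / σ)| ≤ 2 / σ ^ 2 :=
          abs_gaussPdf_mul_deriv_std_factor_le hσpos _
      _ ≤ 2 / s ^ 2 := by gcongr
      _ = 2 * s / s ^ 3 := by field_simp
      _ ≤ 2 * C₂ / s ^ 3 := by gcongr
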